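/- (Theorem 4, fixed-point part, example-based control / RCE setting.) Let p_e : S → ℝ satisfy p_e s ≥ 0 for all s. Let β be a policy with β s a > 0 for all s, a, and π a policy with π s a > 0 for all s, a. Define the behavioral RCE operator (T_β^E Q̃)(s,a) = (1-γ) · p_e s + γ · ∑_{s'} P s a s' · ∑_{a'} β s' a' · Q̃(s',a'), and let Q̃^β be its unique fixed point. Define the regularized RCE operator (U Q)(s,a) = ( (1-γ) · p_e s + γ · ∑_{s'} P s a s' · ∑_{a'} π s' a' · Q(s',a') ) · (β s a / π s a). Then for any Q₀ : S × A → ℝ, the iterates Q_{t+1} = U Q_t converge pointwise to Q*(s,a) = Q̃^β(s,a) · β s a / π s a, which is the unique fixed point of U. -/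

import Mathlib

open Finset Filter Topology

/-- Averaging against a probability vector preserves a uniform bound on absolute values. -/
theorem abs_sum_mul_le_of_sum_eq_one {ι : Type*} [Fintype ι] {w f : ι → ℝ} {C : ℝ}
    (hw0 : ∀ i, 0 ≤ w i) (hw1 : ∑ i, w i = 1) (hf : ∀ i, |f i| ≤ C) :
    |∑ i, w i * f i| ≤ C :=
  calc |∑ i, w i * f i| ≤ ∑ i, |w i * f i| := abs_sum_le_sum_abs _ _
    _ ≤ ∑ i, w i * C := by
      refine sum_le_sum fun i _ => ?_
      rw [abs_mul, abs_of_nonneg (hw0 i)]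
      exact mul_le_mul_of_nonneg_left (hf i) (hw0 i)
    _ = C := by rw [← sum_mul, hw1, one_mul]

/-- Iterates of the discounted homogeneous policy-evaluation operator tend to zero. -/
theorem tendsto_zero_of_discounted_step {S A : Type*} [Fintype S] [Fintype A]
    {P : S → A → S → ℝ} (hP0 : ∀ s a s', 0 ≤ P s a s') (hP1 : ∀ s a, ∑ s', P s a s' = 1)
    {β : S → A → ℝ} (hβ0 : ∀ s a, 0 ≤ β s a) (hβ1 : ∀ s, ∑ a, β s a = 1)
    {γ : ℝ} (hγ0 : 0 ≤ γ) (hγ1 : γ < 1) {D : ℕ → S → A → ℝ}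
    (hD : ∀ t s a, D (t + 1) s a = γ * ∑ s', P s a s' * ∑ a', β s' a' * D t s' a')
    (s : S) (a : A) : Tendsto (fun t => D t s a) atTop (𝓝 0) := by
  have bound : ∀ t s a, |D t s a| ≤ γ ^ t * ∑ s', ∑ a', |D 0 s' a'| := by
    intro t
    induction t with
    | zero =>
      intro s a
      rw [pow_zero, one_mul]
      exact (single_le_sum (f := fun a' => |D 0 s a'|) (fun _ _ => abs_nonneg _)
        (mem_univ a)).trans
        (single_le_sum (f := fun s' => ∑ a', |D 0 s' a'|)
          (fun _ _ => sum_nonneg fun _ _ => abs_nonneg _) (mem_univ s))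
    | succ t ih =>
      intro s a
      rw [hD, abs_mul, abs_of_nonneg hγ0, pow_succ', mul_assoc]
      exact mul_le_mul_of_nonneg_left
        (abs_sum_mul_le_of_sum_eq_one (hP0 s a) (hP1 s a) fun s' =>
          abs_sum_mul_le_of_sum_eq_one (hβ0 s') (hβ1 s') (ih s')) hγ0
  refine squeeze_zero_norm (fun t => bound t s a) ?_
  simpa using (tendsto_pow_atTop_nhds_zero_of_lt_one hγ0 hγ1).mul_const (∑ s', ∑ a', |D 0 s' a'|)

/-- Theorem 4 (fixed-point part, example-based control / RCE): the iterates of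
the regularized RCE operator converge pointwise to
`Q̃^β(s,a) · β(a|s) / π(a|s)`, which is its unique fixed point. -/
theorem rce_regularized_critic_convergence
    {S A : Type*} [Fintype S] [Fintype A] [Nonempty S] [Nonempty A]
    (P : S → A → S → ℝ) (hP0 : ∀ s a s', 0 ≤ P s a s')
    (hP1 : ∀ s a, ∑ s', P s a s' = 1)
    (pe : S → ℝ) (hpe : ∀ s, 0 ≤ pe s)
    (β : S → A → ℝ) (hβ0 : ∀ s a, 0 < β s a) (hβ1 : ∀ s, ∑ a, β s a = 1)
    (π : S → A → ℝ) (hπ0 : ∀ s a, 0 < π s a) (hπ1 : ∀ s, ∑ a, π s a = 1)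
    (γ : ℝ) (hγ0 : 0 ≤ γ) (hγ1 : γ < 1)
    (Qβ : S × A → ℝ)
    (hQβ : ∀ s a, Qβ (s, a) =
      (1 - γ) * pe s + γ * ∑ s', P s a s' * ∑ a', β s' a' * Qβ (s', a'))
    (Q₀ : S × A → ℝ) (Qseq : ℕ → S × A → ℝ) (hQ0 : Qseq 0 = Q₀)
    (hstep : ∀ t s a, Qseq (t + 1) (s, a) =
      ((1 - γ) * pe s + γ * ∑ s', P s a s' * ∑ a', π s' a' * Qseq t (s', a'))
        * (β s a / π s a)) :
    (∀ s a, Tendsto (fun t => Qseq t (s, a)) atTop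
      (𝓝 (Qβ (s, a) * β s a / π s a))) ∧
    (∀ Q : S × A → ℝ,
      (∀ s a, Q (s, a) =
        ((1 - γ) * pe s + γ * ∑ s', P s a s' * ∑ a', π s' a' * Q (s', a'))
          * (β s a / π s a)) ↔
      Q = fun sa => Qβ sa * β sa.1 sa.2 / π sa.1 sa.2) := by
  have conv : ∀ q : ℕ → S × A → ℝ,
      (∀ t s a, q (t + 1) (s, a) =
        ((1 - γ) * pe s + γ * ∑ s', P s a s' * ∑ a', π s' a' * q t (s', a'))
          * (β s a / π s a)) →
      ∀ s a, Tendsto (fun t => q t (s, a)) atTop (𝓝 (Qβ (s, a) * β s a / π s a)) := by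
    intro q hq s a
    have hlim := tendsto_zero_of_discounted_step hP0 hP1 (fun s a => (hβ0 s a).le) hβ1 hγ0 hγ1
      (D := fun t s a => q t (s, a) * (π s a / β s a) - Qβ (s, a)) (fun t s a => by
        have hβ := (hβ0 s a).ne'
        have hπ := (hπ0 s a).ne'
        have hsum : ∀ s', ∑ a', β s' a' * (q t (s', a') * (π s' a' / β s' a') - Qβ (s', a')) =
            ∑ a', π s' a' * q t (s', a') - ∑ a', β s' a' * Qβ (s', a') := by
          intro s'
          rw [← sum_sub_distrib]
          refine sum_congr rfl fun a' _ => ?_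
          have := (hβ0 s' a').ne'
          field_simp
        simp only [hsum]
        simp only [mul_sub, sum_sub_distrib]
        rw [hq, mul_assoc, div_mul_div_cancel₀ hπ, div_self hβ, hQβ s a]
        ring) s a
    have h := (hlim.add_const (Qβ (s, a))).mul_const (β s a / π s a)
    rw [zero_add, ← mul_div_assoc] at h
    refine h.congr fun t => ?_
    have hβ := (hβ0 s a).ne'
    have hπ := (hπ0 s a).ne'
    field_simp
    ring
  refine ⟨conv Qseq hstep, fun Q => ⟨fun hQ => ?_, ?_⟩⟩
  · funext ⟨s, a⟩
    exact tendsto_nhds_unique tendsto_const_nhds (conv (fun _ => Q) (fun _ => hQ) s a)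
  · rintro rfl s a
    have hsum : ∀ s', ∑ a', π s' a' * (Qβ (s', a') * β s' a' / π s' a') =
        ∑ a', β s' a' * Qβ (s', a') := by
      intro s'
      refine sum_congr rfl fun a' _ => ?_
      have := (hπ0 s' a').ne'
      field_simp
    simp only [hsum]
    rw [← hQβ s a, mul_div_assoc]
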